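/- Assume δ ≠ 0. Let Λ ⊆ {1,…,c} be a set of v ≥ 1 labels and let p̄_Λ be a real number with ∑_{j∈Λ} Pr(j ∈ f_{k'}(X)) ≤ p̄_Λ and 0 < p̄_Λ/k' < 1. Then min_{j∈Λ} Pr(j ∈ f_{k'}(Y)) ≤ (k'/v) · Φ(Φ⁻¹(p̄_Λ/k') + ‖δ‖₂/σ). -/

import Mathlib

open MeasureTheory ProbabilityTheory

/-- Isotropic Gaussian measure `N(m, σ²I)` on `ℝ^d`, as a product of 1-D Gaussians. -/
noncomputable def gaussPi (d : ℕ) (m : Fin d → ℝ) (σ : ℝ) : Measure (Fin d → ℝ) :=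
  Measure.pi fun i => gaussianReal (m i) ⟨σ ^ 2, sq_nonneg σ⟩

/-- Standard Gaussian CDF `Φ`. -/
noncomputable def Phi (x : ℝ) : ℝ := (gaussianReal 0 1 (Set.Iic x)).toReal

/-- Inverse of the standard Gaussian CDF, `Φ⁻¹` (genuine inverse on `(0,1)` since `Φ` is a
strictly increasing continuous bijection from `ℝ` onto `(0,1)`). -/
noncomputable def PhiInv : ℝ → ℝ := Function.invFun Phi

/-- Euclidean dot product `aᵀb` on `ℝ^d`. -/
noncomputable def dotp (d : ℕ) (a b : Fin d → ℝ) : ℝ := ∑ i, a i * b i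

/-- Euclidean norm `‖a‖₂` on `ℝ^d`. -/
noncomputable def enorm2 (d : ℕ) (a : Fin d → ℝ) : ℝ := Real.sqrt (∑ i, a i ^ 2)

lemma lintegral_pi_prod_eq_prod {ι : Type*} [Fintype ι] {α : ι → Type*}
    [∀ i, MeasurableSpace (α i)] (μ : ∀ i, Measure (α i)) [∀ i, IsProbabilityMeasure (μ i)]
    (g : ∀ i, α i → ENNReal) (hg : ∀ i, Measurable (g i)) :
    ∫⁻ w, ∏ i, g i (w i) ∂(Measure.pi μ) = ∏ i, ∫⁻ t, g i t ∂(μ i) := by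
  rw [lintegral_prod_eq_prod_lintegral_of_indepFun Finset.univ (fun i (w : ∀ i, α i) => g i (w i))
    (iIndepFun_pi fun i => (hg i).aemeasurable) fun i => (hg i).comp (measurable_pi_apply i)]
  exact Finset.prod_congr rfl fun i _ => (measurePreserving_eval μ i).lintegral_comp (hg i)

lemma pi_withDensity {ι : Type*} [Fintype ι] {α : ι → Type*}
    [∀ i, MeasurableSpace (α i)] (μ ν : ∀ i, Measure (α i)) [∀ i, IsProbabilityMeasure (μ i)]
    [∀ i, SigmaFinite (ν i)] (g : ∀ i, α i → ENNReal) (hg : ∀ i, Measurable (g i))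
    (hν : ∀ i, ν i = (μ i).withDensity (g i)) :
    Measure.pi ν = (Measure.pi μ).withDensity fun w => ∏ i, g i (w i) := by
  refine Measure.pi_eq fun s hs => ?_
  have hind (w : ∀ i, α i) : (Set.univ.pi s).indicator (fun w => ∏ i, g i (w i)) w =
      ∏ i, (s i).indicator (g i) (w i) := by
    by_cases hw : w ∈ Set.univ.pi s
    · rw [Set.indicator_of_mem hw]
      exact Finset.prod_congr rfl fun i _ => (Set.indicator_of_mem (hw i trivial) _).symm
    · rw [Set.indicator_of_notMem hw]
      obtain ⟨i, hi⟩ : ∃ i, w i ∉ s i := by simpa [Set.mem_pi] using hw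
      exact (Finset.prod_eq_zero (Finset.mem_univ i) (Set.indicator_of_notMem hi _)).symm
  rw [withDensity_apply _ (.univ_pi hs), ← lintegral_indicator (.univ_pi hs)]
  simp_rw [hind, hν]
  rw [lintegral_pi_prod_eq_prod μ _ fun i => (hg i).indicator (hs i)]
  refine Finset.prod_congr rfl fun i _ => ?_
  rw [lintegral_indicator (hs i), withDensity_apply _ (hs i)]

lemma gaussianReal_add_eq_withDensity (m δ : ℝ) {σ : ℝ} (hσ : 0 < σ) :
    gaussianReal (m + δ) (σ ^ 2).toNNReal =
      (gaussianReal m (σ ^ 2).toNNReal).withDensity fun t =>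
        ENNReal.ofReal (Real.exp ((δ * (t - m) - δ ^ 2 / 2) / σ ^ 2)) := by
  have hv : (σ ^ 2).toNNReal ≠ 0 := (Real.toNNReal_pos.2 (pow_pos hσ 2)).ne'
  rw [gaussianReal_of_var_ne_zero _ hv, gaussianReal_of_var_ne_zero _ hv,
    ← withDensity_mul _ (measurable_gaussianPDF _ _) (by fun_prop)]
  congr 1
  ext t
  rw [Pi.mul_apply, gaussianPDF, gaussianPDF,
    ← ENNReal.ofReal_mul (gaussianPDFReal_nonneg _ _ _), gaussianPDFReal, gaussianPDFReal,
    mul_assoc _ (Real.exp _), ← Real.exp_add]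
  congr 3
  rw [Real.coe_toNNReal _ (sq_nonneg σ)]
  field_simp
  ring

lemma gaussPi_eq_pi (d : ℕ) (m : Fin d → ℝ) (σ : ℝ) :
    gaussPi d m σ = Measure.pi fun i => gaussianReal (m i) (σ ^ 2).toNNReal := by
  have h : (σ ^ 2).toNNReal = ⟨σ ^ 2, sq_nonneg σ⟩ := Real.toNNReal_of_nonneg (sq_nonneg σ)
  rw [h]
  rfl

instance isProbabilityMeasure_gaussPi (d : ℕ) (m : Fin d → ℝ) (σ : ℝ) :
    IsProbabilityMeasure (gaussPi d m σ) := by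
  rw [gaussPi_eq_pi]; infer_instance

lemma gaussPi_add_eq_withDensity {d : ℕ} (x δ : Fin d → ℝ) {σ : ℝ} (hσ : 0 < σ) :
    gaussPi d (x + δ) σ = (gaussPi d x σ).withDensity fun w =>
      ENNReal.ofReal (Real.exp (∑ i, (δ i * (w i - x i) - δ i ^ 2 / 2) / σ ^ 2)) := by
  rw [gaussPi_eq_pi, gaussPi_eq_pi]
  simp_rw [Pi.add_apply]
  rw [pi_withDensity _ _ _ (fun i => by fun_prop)
    fun i => gaussianReal_add_eq_withDensity (x i) (δ i) hσ]
  congr 1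
  ext w
  rw [Real.exp_sum, ENNReal.ofReal_prod_of_nonneg fun _ _ => (Real.exp_pos _).le]

lemma gaussPi_map_linear {d : ℕ} (m u : Fin d → ℝ) {σ : ℝ} (hu : ∑ i, u i ^ 2 * σ ^ 2 = 1) :
    (gaussPi d m σ).map (fun w => ∑ i, u i * w i) = gaussianReal (∑ i, u i * m i) 1 := by
  have hT : Measurable fun w : Fin d → ℝ => ∑ i, u i * w i := by fun_prop
  have := Measure.isProbabilityMeasure_map (μ := gaussPi d m σ) hT.aemeasurable
  refine Measure.ext_of_charFun (funext fun t => ?_)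
  have h1 : charFun ((gaussPi d m σ).map fun w => ∑ i, u i * w i) t =
      ∏ i, charFun (gaussianReal (m i) (σ ^ 2).toNNReal) (u i * t) := by
    simp_rw [charFun_apply_real]
    rw [integral_map hT.aemeasurable (by fun_prop), gaussPi_eq_pi, ← integral_fintype_prod_eq_prod]
    congr 1
    ext w
    rw [← Complex.exp_sum]
    congr 1
    push_cast
    rw [Finset.mul_sum, Finset.sum_mul]
    exact Finset.sum_congr rfl fun i _ => by ring
  have hu' : ∑ i, (u i : ℂ) ^ 2 * (σ : ℂ) ^ 2 = 1 := mod_cast hu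
  simp_rw [h1, charFun_gaussianReal, ← Complex.exp_sum]
  congr 1
  rw [Finset.sum_sub_distrib]
  push_cast
  congr 1
  · rw [Finset.mul_sum, Finset.sum_mul]
    exact Finset.sum_congr rfl fun i _ => by ring
  · calc _ = (∑ i, (u i : ℂ) ^ 2 * (σ : ℂ) ^ 2) * ((t : ℂ) ^ 2 / 2) := by
          rw [Finset.sum_mul]
          refine Finset.sum_congr rfl fun i _ => ?_
          rw [Real.coe_toNNReal _ (sq_nonneg σ)]
          push_cast
          ring
      _ = _ := by rw [hu']; simp

lemma gaussianReal_one_real_Iic (m y : ℝ) : (gaussianReal m 1).real (Set.Iic y) = Phi (y - m) := by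
  have h : gaussianReal m 1 = (gaussianReal 0 1).map (· + m) := by
    rw [gaussianReal_map_add_const, zero_add]
  rw [h, measureReal_def, Measure.map_apply (measurable_add_const m) measurableSet_Iic, Phi]
  congr 2
  ext t
  simp [le_sub_iff_add_le]

lemma gaussPi_real_halfspace {d : ℕ} (m u : Fin d → ℝ) {σ : ℝ} (hu : ∑ i, u i ^ 2 * σ ^ 2 = 1)
    (y : ℝ) : (gaussPi d m σ).real {w | ∑ i, u i * w i ≤ y} = Phi (y - ∑ i, u i * m i) := by
  rw [← gaussianReal_one_real_Iic, ← gaussPi_map_linear m u hu,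
    map_measureReal_apply (by fun_prop) measurableSet_Iic]
  rfl

lemma Phi_eq_cdf : Phi = cdf (gaussianReal 0 1) :=
  funext fun x => (cdf_eq_real _ x).symm

lemma continuous_Phi : Continuous Phi := by
  rw [Phi_eq_cdf, continuous_iff_continuousAt]
  intro a
  have := nullSingletonClass_gaussianReal (μ := 0) (v := 1) one_ne_zero
  have h0 : (cdf (gaussianReal 0 1)).measure {a} = 0 := by
    rw [measure_cdf]; exact measure_singleton a
  rw [StieltjesFunction.measure_singleton, ENNReal.ofReal_eq_zero, sub_nonpos] at h0
  rw [(monotone_cdf _).continuousAt_iff_leftLim_eq_rightLim, StieltjesFunction.rightLim_eq]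
  exact le_antisymm ((monotone_cdf _).leftLim_le le_rfl) h0

lemma Phi_PhiInv {p : ℝ} (h0 : 0 < p) (h1 : p < 1) : Phi (PhiInv p) = p := by
  refine Function.invFun_eq (mem_range_of_exists_le_of_exists_ge continuous_Phi ?_ ?_)
  · rw [Phi_eq_cdf]
    exact ((tendsto_cdf_atBot _).eventually_le_const h0).exists
  · rw [Phi_eq_cdf]
    exact ((tendsto_cdf_atTop _).eventually_const_le h1).exists

/-- **Neyman–Pearson lemma** for randomized tests. -/
lemma integral_le_of_likelihood_ratio {α : Type*} [MeasurableSpace α] {P Q : Measure α}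
    [IsFiniteMeasure P] [IsFiniteMeasure Q] {L : α → ℝ} (hL : Measurable L)
    (hL0 : ∀ w, 0 ≤ L w) (hQ : Q = P.withDensity fun w => ENNReal.ofReal (L w))
    {l : ℝ} (hl : 0 ≤ l) {B : Set α} (hB : MeasurableSet B) (hB1 : ∀ w ∈ B, l ≤ L w)
    (hB2 : ∀ w ∉ B, L w ≤ l) {h : α → ℝ} (hh : Measurable h) (hh0 : ∀ w, 0 ≤ h w)
    (hh1 : ∀ w, h w ≤ 1) (hP : ∫ w, h w ∂P ≤ P.real B) : ∫ w, h w ∂Q ≤ Q.real B := by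
  have hLfin : Integrable L P := by
    refine ⟨hL.aestronglyMeasurable, ?_⟩
    rw [hasFiniteIntegral_iff_ofReal (.of_forall hL0), ← setLIntegral_univ,
      ← withDensity_apply _ .univ, ← hQ]
    exact measure_lt_top Q _
  have hint (g : α → ℝ) : ∫ w, g w ∂Q = ∫ w, g w * L w ∂P := by
    rw [hQ, integral_withDensity_eq_integral_toReal_smul (by fun_prop)
      (.of_forall fun _ => ENNReal.ofReal_lt_top)]
    refine integral_congr_ae (.of_forall fun w => ?_)
    simp [ENNReal.toReal_ofReal (hL0 w), mul_comm]
  set b : α → ℝ := B.indicator 1 with hb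
  have hbm : Measurable b := measurable_one.indicator hB
  have hbound {g : α → ℝ} (hg0 : ∀ w, 0 ≤ g w) (hg1 : ∀ w, g w ≤ 1) (w : α) : ‖g w‖ ≤ 1 := by
    rw [Real.norm_eq_abs, abs_of_nonneg (hg0 w)]; exact hg1 w
  have hb1 (w : α) : ‖b w‖ ≤ 1 := by
    by_cases hw : w ∈ B <;> simp [hb, hw]
  have hhP : Integrable h P :=
    .of_bound hh.aestronglyMeasurable 1 (.of_forall (hbound hh0 hh1))
  have hbP : Integrable b P := .of_bound hbm.aestronglyMeasurable 1 (.of_forall hb1)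
  have hhL : Integrable (fun w => h w * L w) P :=
    hLfin.bdd_mul hh.aestronglyMeasurable (.of_forall (hbound hh0 hh1))
  have hbL : Integrable (fun w => b w * L w) P :=
    hLfin.bdd_mul hbm.aestronglyMeasurable (.of_forall hb1)
  rw [← integral_indicator_one hB] at hP ⊢
  rw [hint, hint]
  have key : ∫ w, (h w * L w - b w * L w) ∂P ≤ ∫ w, l * (h w - b w) ∂P := by
    refine integral_mono (hhL.sub hbL) ((hhP.sub hbP).const_mul l) fun w => ?_
    by_cases hw : w ∈ B
    · have : b w = 1 := by simp [hb, hw]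
      simp only [this]
      nlinarith [hB1 w hw, hh1 w]
    · have : b w = 0 := by simp [hb, hw]
      simp only [this]
      nlinarith [hB2 w hw, hh0 w]
  rw [integral_sub hhL hbL, integral_const_mul, integral_sub hhP hbP] at key
  nlinarith [mul_nonneg hl (sub_nonneg.2 hP)]

/-- A randomized test whose mean under `N(x,σ²I)` is at most `p` has mean at most
`Φ(Φ⁻¹(p) + ‖δ‖₂/σ)` under `N(x+δ,σ²I)`. -/
lemma integral_gaussPi_add_le {d : ℕ} (x δ : Fin d → ℝ) (hδ : δ ≠ 0) {σ : ℝ} (hσ : 0 < σ)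
    {h : (Fin d → ℝ) → ℝ} (hh : Measurable h) (hh0 : ∀ w, 0 ≤ h w) (hh1 : ∀ w, h w ≤ 1)
    {p : ℝ} (hp0 : 0 < p) (hp1 : p < 1) (hP : ∫ w, h w ∂(gaussPi d x σ) ≤ p) :
    ∫ w, h w ∂(gaussPi d (x + δ) σ) ≤ Phi (PhiInv p + enorm2 d δ / σ) := by
  have hsum : 0 < ∑ i, δ i ^ 2 := by
    obtain ⟨i, hi⟩ := Function.ne_iff.1 hδ
    exact Finset.sum_pos' (fun i _ => sq_nonneg _) ⟨i, Finset.mem_univ i, sq_pos_of_ne_zero hi⟩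
  set n := enorm2 d δ with hn
  have hn0 : 0 < n := Real.sqrt_pos.2 hsum
  have hn2 : ∑ i, δ i ^ 2 = n ^ 2 := (Real.sq_sqrt hsum.le).symm
  set u : Fin d → ℝ := fun i => -δ i / (σ * n) with hu_def
  have hu : ∑ i, u i ^ 2 * σ ^ 2 = 1 := by
    calc ∑ i, u i ^ 2 * σ ^ 2 = ∑ i, δ i ^ 2 / n ^ 2 :=
          Finset.sum_congr rfl fun i _ => by simp only [hu_def]; field_simp
      _ = 1 := by rw [← Finset.sum_div, hn2]; field_simp
  have huδ : ∑ i, u i * δ i = -(n / σ) := by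
    calc ∑ i, u i * δ i = ∑ i, δ i ^ 2 * (-1 / (σ * n)) :=
          Finset.sum_congr rfl fun i _ => by simp only [hu_def]; field_simp
      _ = -(n / σ) := by rw [← Finset.sum_mul, hn2]; field_simp
  set a := PhiInv p
  set y := a + ∑ i, u i * x i with hy
  have hexp (w : Fin d → ℝ) : ∑ i, (δ i * (w i - x i) - δ i ^ 2 / 2) / σ ^ 2 =
      -(n / σ) * (∑ i, u i * w i - ∑ i, u i * x i) - n ^ 2 / (2 * σ ^ 2) := by
    rw [← hn2, ← Finset.sum_sub_distrib, Finset.mul_sum, Finset.sum_div, ← Finset.sum_sub_distrib]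
    exact Finset.sum_congr rfl fun i _ => by simp only [hu_def]; field_simp; ring
  have hr : 0 < n / σ := div_pos hn0 hσ
  have hPB : (gaussPi d x σ).real {w | ∑ i, u i * w i ≤ y} = p := by
    rw [gaussPi_real_halfspace x u hu, hy, add_sub_cancel_right, Phi_PhiInv hp0 hp1]
  have hQB : (gaussPi d (x + δ) σ).real {w | ∑ i, u i * w i ≤ y} = Phi (a + n / σ) := by
    rw [gaussPi_real_halfspace (x + δ) u hu]
    simp only [Pi.add_apply, mul_add, Finset.sum_add_distrib, huδ, hy]
    congr 1
    ring
  rw [← hQB]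
  refine integral_le_of_likelihood_ratio (by fun_prop) (fun w => (Real.exp_pos _).le)
    (gaussPi_add_eq_withDensity x δ hσ) (Real.exp_pos (-(n / σ) * a - n ^ 2 / (2 * σ ^ 2))).le
    (measurableSet_le (by fun_prop) measurable_const) (fun w hw => ?_) (fun w hw => ?_)
    hh hh0 hh1 (hP.trans_eq hPB.symm)
  · rw [Set.mem_ofPred_eq] at hw
    rw [hexp, Real.exp_le_exp]
    nlinarith
  · rw [Set.mem_ofPred_eq, not_le] at hw
    rw [hexp, Real.exp_le_exp]
    nlinarith

/-- Joint upper bound for a set `Λ` of `v ≥ 1` labels: if `∑_{j∈Λ} Pr(j ∈ f_{k'}(X)) ≤ p̄_Λ`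
and `0 < p̄_Λ/k' < 1`, then `min_{j∈Λ} Pr(j ∈ f_{k'}(Y)) ≤ (k'/v)·Φ(Φ⁻¹(p̄_Λ/k') + ‖δ‖₂/σ)`,
where `X ~ N(x,σ²I)`, `Y ~ N(x+δ,σ²I)` and the base classifier `f` outputs exactly
`k'` labels from `{1,…,c}`. -/
theorem stmt13 {d : ℕ} (c k' : ℕ) (hk' : 1 ≤ k')
    (x δ : Fin d → ℝ) (hδ : δ ≠ 0) (σ : ℝ) (hσ : 0 < σ)
    (f : (Fin d → ℝ) → Finset (Fin c)) (hfcard : ∀ w, (f w).card = k')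
    (hfm : ∀ i : Fin c, MeasurableSet {w : Fin d → ℝ | i ∈ f w})
    (Λ : Finset (Fin c)) (v : ℕ) (hv : 1 ≤ v) (hcard : Λ.card = v)
    (pL : ℝ)
    (hge : ∑ j ∈ Λ, ((gaussPi d x σ) {w | j ∈ f w}).toReal ≤ pL)
    (h0 : 0 < pL / (k' : ℝ)) (hlt : pL / (k' : ℝ) < 1) :
    Λ.inf' (Finset.card_pos.mp (by omega))
        (fun j => ((gaussPi d (x + δ) σ) {w | j ∈ f w}).toReal) ≤
      (k' : ℝ) / (v : ℝ) * Phi (PhiInv (pL / (k' : ℝ)) + enorm2 d δ / σ) := by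
  have hk : (0 : ℝ) < k' := by exact_mod_cast hk'
  have hv0 : (0 : ℝ) < v := by exact_mod_cast hv
  set h : (Fin d → ℝ) → ℝ := fun w => (∑ j ∈ Λ, {w | j ∈ f w}.indicator 1 w) / k' with hh
  have hsum (w : Fin d → ℝ) :
      ∑ j ∈ Λ, ({w | j ∈ f w}.indicator 1 w : ℝ) = (Λ ∩ f w).card := by
    simp [Set.indicator_apply, ← Finset.filter_mem_eq_inter]
  have hmeas : Measurable h :=
    (Finset.measurable_sum _ fun j _ => measurable_one.indicator (hfm j)).div_const _
  have hint (m : Fin d → ℝ) : ∫ w, h w ∂(gaussPi d m σ) =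
      (∑ j ∈ Λ, (gaussPi d m σ {w | j ∈ f w}).toReal) / k' := by
    simp only [hh]
    rw [integral_div, integral_finsetSum (f := fun j => {w | j ∈ f w}.indicator (1 : (Fin d → ℝ) → ℝ)) _
      fun j _ => (integrable_const (1 : ℝ)).indicator (hfm j)]
    congr 1
    exact Finset.sum_congr rfl fun j _ => integral_indicator_one (hfm j)
  have key := integral_gaussPi_add_le x δ hδ hσ hmeas
    (fun w => by simp only [hh, hsum]; positivity)
    (fun w => by
      simp only [hh, hsum]
      rw [div_le_one hk, ← hfcard w]
      exact_mod_cast Finset.card_le_card Finset.inter_subset_right)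
    h0 hlt (by rw [hint]; gcongr)
  rw [hint, div_le_iff₀ hk] at key
  rw [div_mul_eq_mul_div, le_div_iff₀ hv0, mul_comm, mul_comm (k' : ℝ)]
  refine le_trans ?_ key
  rw [← nsmul_eq_mul]
  refine (congrArg (· • _) hcard.symm).trans_le ?_
  exact Finset.card_nsmul_le_sum _ _ _ fun j hj => Finset.inf'_le _ hj
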